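/- Let (u,v) be a smooth solution of the Pavlov–Mikhalev system on ℝ³. Then the pair (φ^u, φ^v) with φ^u = 2x·u_x + y·u_y − 3u and φ^v = 2x·v_x + y·v_y satisfies the linearized system, i.e., it is a symmetry generating function (the symmetry φ₂). -/

import Mathlib

noncomputable section

/-- Partial derivative with respect to the first coordinate `t`. -/
def Dt (f : ℝ → ℝ → ℝ → ℝ) : ℝ → ℝ → ℝ → ℝ := fun t x y => deriv (fun s => f s x y) t

/-- Partial derivative with respect to the second coordinate `x`. -/
def Dx (f : ℝ → ℝ → ℝ → ℝ) : ℝ → ℝ → ℝ → ℝ := fun t x y => deriv (fun s => f t s y) x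

/-- Partial derivative with respect to the third coordinate `y`. -/
def Dy (f : ℝ → ℝ → ℝ → ℝ) : ℝ → ℝ → ℝ → ℝ := fun t x y => deriv (fun s => f t x s) y

/-- `f` is a smooth function on `ℝ³` (given in curried form, coordinates `(t, x, y)`). -/
def Smooth3 (f : ℝ → ℝ → ℝ → ℝ) : Prop :=
  ContDiff ℝ (⊤ : ℕ∞) (fun p : ℝ × ℝ × ℝ => f p.1 p.2.1 p.2.2)

/-- The Pavlov–Mikhalev equation `u_yy = u_xt − u_x·u_xy + u_y·u_xx`. -/
def PMu (u : ℝ → ℝ → ℝ → ℝ) : Prop :=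
  ∀ t x y : ℝ, Dy (Dy u) t x y =
    Dt (Dx u) t x y - Dx u t x y * Dy (Dx u) t x y + Dy u t x y * Dx (Dx u) t x y

/-- The second equation of the two-component Pavlov–Mikhalev system:
`v_yy = v_xt − u_x·v_xy − 2·v_y·u_xx + 2·v_x·u_xy + u_y·v_xx`. -/
def PMv (u v : ℝ → ℝ → ℝ → ℝ) : Prop :=
  ∀ t x y : ℝ, Dy (Dy v) t x y =
    Dt (Dx v) t x y - Dx u t x y * Dy (Dx v) t x y
      - 2 * Dy v t x y * Dx (Dx u) t x y + 2 * Dx v t x y * Dy (Dx u) t x y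
      + Dy u t x y * Dx (Dx v) t x y

/-- First equation of the linearized system applied to `A = φ^u`:
`φ^u_yy = φ^u_xt + u_xx·φ^u_y + u_y·φ^u_xx − u_x·φ^u_xy − u_xy·φ^u_x`. -/
def LinU (u A : ℝ → ℝ → ℝ → ℝ) : Prop :=
  ∀ t x y : ℝ, Dy (Dy A) t x y =
    Dt (Dx A) t x y + Dx (Dx u) t x y * Dy A t x y + Dy u t x y * Dx (Dx A) t x y
      - Dx u t x y * Dy (Dx A) t x y - Dy (Dx u) t x y * Dx A t x y

/-- Second equation of the linearized system applied to `(A, B) = (φ^u, φ^v)`. -/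
def LinV (u v A B : ℝ → ℝ → ℝ → ℝ) : Prop :=
  ∀ t x y : ℝ, Dy (Dy B) t x y =
    2 * Dx v t x y * Dy (Dx A) t x y - Dy (Dx v) t x y * Dx A t x y
      + Dx (Dx v) t x y * Dy A t x y - 2 * Dy v t x y * Dx (Dx A) t x y
      + Dt (Dx B) t x y + 2 * Dy (Dx u) t x y * Dx B t x y
      - 2 * Dx (Dx u) t x y * Dy B t x y + Dy u t x y * Dx (Dx B) t x y
      - Dx u t x y * Dy (Dx B) t x y

/-- `(A,B)` is a symmetry generating function of the Pavlov–Mikhalev system over `(u,v)`. -/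
def IsSymmetry (u v A B : ℝ → ℝ → ℝ → ℝ) : Prop := LinU u A ∧ LinV u v A B

/-- First equation of the tangent system over a solution `(u,v)`:
`p_yy = u_y·p_xx − u_xy·p_x − u_x·p_xy + u_xx·p_y + p_xt`. -/
def TanP (u p : ℝ → ℝ → ℝ → ℝ) : Prop :=
  ∀ t x y : ℝ, Dy (Dy p) t x y =
    Dy u t x y * Dx (Dx p) t x y - Dy (Dx u) t x y * Dx p t x y
      - Dx u t x y * Dy (Dx p) t x y + Dx (Dx u) t x y * Dy p t x y + Dt (Dx p) t x y

/-- Second equation of the tangent system over a solution `(u,v)`: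
`q_yy = 2·v_x·p_xy + v_xx·p_y − v_xy·p_x − 2·v_y·p_xx + 2·u_xy·q_x + u_y·q_xx
  − u_x·q_xy − 2·u_xx·q_y + q_xt`. -/
def TanQ (u v p q : ℝ → ℝ → ℝ → ℝ) : Prop :=
  ∀ t x y : ℝ, Dy (Dy q) t x y =
    2 * Dx v t x y * Dy (Dx p) t x y + Dx (Dx v) t x y * Dy p t x y
      - Dy (Dx v) t x y * Dx p t x y - 2 * Dy v t x y * Dx (Dx p) t x y
      + 2 * Dy (Dx u) t x y * Dx q t x y + Dy u t x y * Dx (Dx q) t x y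
      - Dx u t x y * Dy (Dx q) t x y - 2 * Dx (Dx u) t x y * Dy q t x y
      + Dt (Dx q) t x y

/-- The inhomogeneous Euler operator `2x ∂_x + y ∂_y + c`. -/
def weightedEuler (c : ℝ) (f : ℝ → ℝ → ℝ → ℝ) : ℝ → ℝ → ℝ → ℝ :=
  fun t x y => 2 * x * Dx f t x y + y * Dy f t x y + c * f t x y

namespace Smooth3

variable {f g : ℝ → ℝ → ℝ → ℝ}

theorem differentiable_uncurried (hf : Smooth3 f) :
    Differentiable ℝ (fun p : ℝ × ℝ × ℝ => f p.1 p.2.1 p.2.2) :=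
  ContDiff.differentiable hf (by simp)

theorem hasDerivAt_t_fderiv (hf : Smooth3 f) (t x y : ℝ) :
    HasDerivAt (fun s => f s x y)
      (fderiv ℝ (fun p : ℝ × ℝ × ℝ => f p.1 p.2.1 p.2.2) (t, x, y) (1, 0, 0)) t := by
  have h := (hf.differentiable_uncurried (t, x, y)).hasFDerivAt
  exact h.comp_hasDerivAt t
    ((hasDerivAt_id' t).prodMk ((hasDerivAt_const t x).prodMk (hasDerivAt_const t y)))

theorem hasDerivAt_x_fderiv (hf : Smooth3 f) (t x y : ℝ) :
    HasDerivAt (fun s => f t s y)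
      (fderiv ℝ (fun p : ℝ × ℝ × ℝ => f p.1 p.2.1 p.2.2) (t, x, y) (0, 1, 0)) x := by
  have h := (hf.differentiable_uncurried (t, x, y)).hasFDerivAt
  exact h.comp_hasDerivAt x
    ((hasDerivAt_const x t).prodMk ((hasDerivAt_id' x).prodMk (hasDerivAt_const x y)))

theorem hasDerivAt_y_fderiv (hf : Smooth3 f) (t x y : ℝ) :
    HasDerivAt (fun s => f t x s)
      (fderiv ℝ (fun p : ℝ × ℝ × ℝ => f p.1 p.2.1 p.2.2) (t, x, y) (0, 0, 1)) y := by
  have h := (hf.differentiable_uncurried (t, x, y)).hasFDerivAt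
  exact h.comp_hasDerivAt y
    ((hasDerivAt_const y t).prodMk ((hasDerivAt_const y x).prodMk (hasDerivAt_id' y)))

theorem hasDerivAt_t (hf : Smooth3 f) (t x y : ℝ) :
    HasDerivAt (fun s => f s x y) (Dt f t x y) t :=
  (hf.hasDerivAt_t_fderiv t x y).differentiableAt.hasDerivAt

theorem hasDerivAt_x (hf : Smooth3 f) (t x y : ℝ) :
    HasDerivAt (fun s => f t s y) (Dx f t x y) x :=
  (hf.hasDerivAt_x_fderiv t x y).differentiableAt.hasDerivAt

theorem hasDerivAt_y (hf : Smooth3 f) (t x y : ℝ) :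
    HasDerivAt (fun s => f t x s) (Dy f t x y) y :=
  (hf.hasDerivAt_y_fderiv t x y).differentiableAt.hasDerivAt

theorem Dt_eq_fderiv (hf : Smooth3 f) :
    (fun p : ℝ × ℝ × ℝ => Dt f p.1 p.2.1 p.2.2) =
      fun p => fderiv ℝ (fun p : ℝ × ℝ × ℝ => f p.1 p.2.1 p.2.2) p (1, 0, 0) :=
  funext fun p => (hf.hasDerivAt_t_fderiv p.1 p.2.1 p.2.2).deriv

theorem Dx_eq_fderiv (hf : Smooth3 f) :
    (fun p : ℝ × ℝ × ℝ => Dx f p.1 p.2.1 p.2.2) =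
      fun p => fderiv ℝ (fun p : ℝ × ℝ × ℝ => f p.1 p.2.1 p.2.2) p (0, 1, 0) :=
  funext fun p => (hf.hasDerivAt_x_fderiv p.1 p.2.1 p.2.2).deriv

theorem Dy_eq_fderiv (hf : Smooth3 f) :
    (fun p : ℝ × ℝ × ℝ => Dy f p.1 p.2.1 p.2.2) =
      fun p => fderiv ℝ (fun p : ℝ × ℝ × ℝ => f p.1 p.2.1 p.2.2) p (0, 0, 1) :=
  funext fun p => (hf.hasDerivAt_y_fderiv p.1 p.2.1 p.2.2).deriv

theorem contDiff_fderiv (hf : Smooth3 f) :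
    ContDiff ℝ (⊤ : ℕ∞) (fderiv ℝ (fun p : ℝ × ℝ × ℝ => f p.1 p.2.1 p.2.2)) :=
  ContDiff.fderiv_right (m := (⊤ : ℕ∞)) hf (by simp)

protected theorem Dt (hf : Smooth3 f) : Smooth3 (Dt f) := by
  unfold Smooth3
  rw [hf.Dt_eq_fderiv]
  exact hf.contDiff_fderiv.clm_apply contDiff_const

protected theorem Dx (hf : Smooth3 f) : Smooth3 (Dx f) := by
  unfold Smooth3
  rw [hf.Dx_eq_fderiv]
  exact hf.contDiff_fderiv.clm_apply contDiff_const

protected theorem Dy (hf : Smooth3 f) : Smooth3 (Dy f) := by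
  unfold Smooth3
  rw [hf.Dy_eq_fderiv]
  exact hf.contDiff_fderiv.clm_apply contDiff_const

theorem add (hf : Smooth3 f) (hg : Smooth3 g) : Smooth3 (f + g) :=
  ContDiff.add hf hg

theorem sub (hf : Smooth3 f) (hg : Smooth3 g) : Smooth3 (f - g) :=
  ContDiff.sub hf hg

theorem mul (hf : Smooth3 f) (hg : Smooth3 g) : Smooth3 (f * g) :=
  ContDiff.mul hf hg

theorem fderiv_fderiv_apply (hf : Smooth3 f) (p v w : ℝ × ℝ × ℝ) :
    fderiv ℝ (fun q => fderiv ℝ (fun p : ℝ × ℝ × ℝ => f p.1 p.2.1 p.2.2) q v) p w =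
      fderiv ℝ (fderiv ℝ (fun p : ℝ × ℝ × ℝ => f p.1 p.2.1 p.2.2)) p w v := by
  have h := (hf.contDiff_fderiv.differentiable (by simp) p).hasFDerivAt
  rw [(h.clm_apply (hasFDerivAt_const v p)).fderiv]
  simp

theorem fderiv_fderiv_comm (hf : Smooth3 f) (p v w : ℝ × ℝ × ℝ) :
    fderiv ℝ (fun q => fderiv ℝ (fun p : ℝ × ℝ × ℝ => f p.1 p.2.1 p.2.2) q v) p w =
      fderiv ℝ (fun q => fderiv ℝ (fun p : ℝ × ℝ × ℝ => f p.1 p.2.1 p.2.2) q w) p v := by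
  rw [hf.fderiv_fderiv_apply, hf.fderiv_fderiv_apply]
  refine (ContDiff.contDiffAt hf).isSymmSndFDerivAt ?_ w v
  rw [minSmoothness_of_isRCLikeNormedField]
  exact WithTop.coe_le_coe.2 (le_top : (2 : ℕ∞) ≤ ⊤)

theorem Dt_Dx (hf : Smooth3 f) (t x y : ℝ) :
    Dt (Dx f) t x y = Dx (Dt f) t x y := by
  have h₁ := congrFun hf.Dx.Dt_eq_fderiv (t, x, y)
  have h₂ := congrFun hf.Dt.Dx_eq_fderiv (t, x, y)
  rw [hf.Dx_eq_fderiv] at h₁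
  rw [hf.Dt_eq_fderiv] at h₂
  exact h₁.trans ((hf.fderiv_fderiv_comm _ _ _).trans h₂.symm)

theorem Dt_Dy (hf : Smooth3 f) (t x y : ℝ) :
    Dt (Dy f) t x y = Dy (Dt f) t x y := by
  have h₁ := congrFun hf.Dy.Dt_eq_fderiv (t, x, y)
  have h₂ := congrFun hf.Dt.Dy_eq_fderiv (t, x, y)
  rw [hf.Dy_eq_fderiv] at h₁
  rw [hf.Dt_eq_fderiv] at h₂
  exact h₁.trans ((hf.fderiv_fderiv_comm _ _ _).trans h₂.symm)

theorem Dx_Dy (hf : Smooth3 f) (t x y : ℝ) :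
    Dx (Dy f) t x y = Dy (Dx f) t x y := by
  have h₁ := congrFun hf.Dy.Dx_eq_fderiv (t, x, y)
  have h₂ := congrFun hf.Dx.Dy_eq_fderiv (t, x, y)
  rw [hf.Dy_eq_fderiv] at h₁
  rw [hf.Dx_eq_fderiv] at h₂
  exact h₁.trans ((hf.fderiv_fderiv_comm _ _ _).trans h₂.symm)

theorem Dt_weightedEuler (hf : Smooth3 f) (c : ℝ) :
    Dt (weightedEuler c f) = weightedEuler c (Dt f) := by
  funext t x y
  refine HasDerivAt.deriv ?_
  refine ((((hf.Dx.hasDerivAt_t t x y).const_mul (2 * x)).add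
    ((hf.Dy.hasDerivAt_t t x y).const_mul y)).add
    ((hf.hasDerivAt_t t x y).const_mul c)).congr_deriv ?_
  simp only [weightedEuler, hf.Dt_Dx, hf.Dt_Dy]

theorem Dx_weightedEuler (hf : Smooth3 f) (c : ℝ) :
    Dx (weightedEuler c f) = weightedEuler (c + 2) (Dx f) := by
  funext t x y
  refine HasDerivAt.deriv ?_
  refine (((((hasDerivAt_id x).const_mul 2).mul (hf.Dx.hasDerivAt_x t x y)).add
    ((hf.Dy.hasDerivAt_x t x y).const_mul y)).add
    ((hf.hasDerivAt_x t x y).const_mul c)).congr_deriv ?_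
  simp only [weightedEuler, hf.Dx_Dy, id]
  ring

theorem Dy_weightedEuler (hf : Smooth3 f) (c : ℝ) :
    Dy (weightedEuler c f) = weightedEuler (c + 1) (Dy f) := by
  funext t x y
  refine HasDerivAt.deriv ?_
  refine ((((hf.Dx.hasDerivAt_y t x y).const_mul (2 * x)).add
    ((hasDerivAt_id y).mul (hf.Dy.hasDerivAt_y t x y))).add
    ((hf.hasDerivAt_y t x y).const_mul c)).congr_deriv ?_
  simp only [weightedEuler, hf.Dx_Dy, id]
  ring

theorem weightedEuler_add (hf : Smooth3 f) (hg : Smooth3 g) (c : ℝ) :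
    weightedEuler c (f + g) = weightedEuler c f + weightedEuler c g := by
  funext t x y
  have hx : Dx (f + g) t x y = _ :=
    ((hf.hasDerivAt_x t x y).add (hg.hasDerivAt_x t x y)).deriv
  have hy : Dy (f + g) t x y = _ :=
    ((hf.hasDerivAt_y t x y).add (hg.hasDerivAt_y t x y)).deriv
  simp only [weightedEuler, Pi.add_apply, hx, hy]
  ring

theorem weightedEuler_sub (hf : Smooth3 f) (hg : Smooth3 g) (c : ℝ) :
    weightedEuler c (f - g) = weightedEuler c f - weightedEuler c g := by
  funext t x y
  have hx : Dx (f - g) t x y = _ :=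
    ((hf.hasDerivAt_x t x y).sub (hg.hasDerivAt_x t x y)).deriv
  have hy : Dy (f - g) t x y = _ :=
    ((hf.hasDerivAt_y t x y).sub (hg.hasDerivAt_y t x y)).deriv
  simp only [weightedEuler, Pi.sub_apply, hx, hy]
  ring

theorem weightedEuler_mul (hf : Smooth3 f) (hg : Smooth3 g) (c d : ℝ) :
    weightedEuler (c + d) (f * g) = weightedEuler c f * g + f * weightedEuler d g := by
  funext t x y
  have hx : Dx (f * g) t x y = _ :=
    ((hf.hasDerivAt_x t x y).mul (hg.hasDerivAt_x t x y)).deriv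
  have hy : Dy (f * g) t x y = _ :=
    ((hf.hasDerivAt_y t x y).mul (hg.hasDerivAt_y t x y)).deriv
  simp only [weightedEuler, Pi.add_apply, Pi.mul_apply, hx, hy]
  ring

end Smooth3

theorem PMu.weightedEuler_eq {u : ℝ → ℝ → ℝ → ℝ} (hu : Smooth3 u) (h : PMu u) :
    weightedEuler (-1) (Dy (Dy u)) =
      weightedEuler (-1) (Dt (Dx u))
        - (weightedEuler (-1) (Dx u) * Dy (Dx u) + Dx u * weightedEuler 0 (Dy (Dx u)))
        + (weightedEuler (-2) (Dy u) * Dx (Dx u) + Dy u * weightedEuler 1 (Dx (Dx u))) := by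
  have e : Dy (Dy u) = Dt (Dx u) - Dx u * Dy (Dx u) + Dy u * Dx (Dx u) := by
    funext t x y
    exact h t x y
  rw [← hu.Dx.weightedEuler_mul hu.Dx.Dy, ← hu.Dy.weightedEuler_mul hu.Dx.Dx, e,
    (hu.Dx.Dt.sub (hu.Dx.mul hu.Dx.Dy)).weightedEuler_add (hu.Dy.mul hu.Dx.Dx),
    hu.Dx.Dt.weightedEuler_sub (hu.Dx.mul hu.Dx.Dy)]
  norm_num

theorem PMv.weightedEuler_eq {u v : ℝ → ℝ → ℝ → ℝ} (hu : Smooth3 u) (hv : Smooth3 v)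
    (h : PMv u v) :
    weightedEuler 2 (Dy (Dy v)) =
      weightedEuler 2 (Dt (Dx v))
        - (weightedEuler (-1) (Dx u) * Dy (Dx v) + Dx u * weightedEuler 3 (Dy (Dx v)))
        - ((weightedEuler 1 (Dy v) * Dx (Dx u) + Dy v * weightedEuler 1 (Dx (Dx u)))
          + (weightedEuler 1 (Dy v) * Dx (Dx u) + Dy v * weightedEuler 1 (Dx (Dx u))))
        + ((weightedEuler 2 (Dx v) * Dy (Dx u) + Dx v * weightedEuler 0 (Dy (Dx u)))
          + (weightedEuler 2 (Dx v) * Dy (Dx u) + Dx v * weightedEuler 0 (Dy (Dx u))))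
        + (weightedEuler (-2) (Dy u) * Dx (Dx v) + Dy u * weightedEuler 4 (Dx (Dx v))) := by
  have e : Dy (Dy v) = Dt (Dx v) - Dx u * Dy (Dx v) - (Dy v * Dx (Dx u) + Dy v * Dx (Dx u))
      + (Dx v * Dy (Dx u) + Dx v * Dy (Dx u)) + Dy u * Dx (Dx v) := by
    funext t x y
    simp only [Pi.add_apply, Pi.sub_apply, Pi.mul_apply, h t x y]
    ring
  have s₁ := hu.Dx.mul hv.Dx.Dy
  have s₂ := hv.Dy.mul hu.Dx.Dx
  have s₃ := hv.Dx.mul hu.Dx.Dy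
  have s₄ := hu.Dy.mul hv.Dx.Dx
  have d₁ := hv.Dx.Dt.sub s₁
  have d₂ := d₁.sub (s₂.add s₂)
  have d₃ := d₂.add (s₃.add s₃)
  rw [← hu.Dx.weightedEuler_mul hv.Dx.Dy, ← hv.Dy.weightedEuler_mul hu.Dx.Dx,
    ← hv.Dx.weightedEuler_mul hu.Dx.Dy, ← hu.Dy.weightedEuler_mul hv.Dx.Dx, e,
    d₃.weightedEuler_add s₄, d₂.weightedEuler_add (s₃.add s₃), d₁.weightedEuler_sub (s₂.add s₂),
    hv.Dx.Dt.weightedEuler_sub s₁, s₂.weightedEuler_add s₂, s₃.weightedEuler_add s₃]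
  norm_num

theorem phi2_is_symmetry (u v : ℝ → ℝ → ℝ → ℝ) (hu : Smooth3 u) (hv : Smooth3 v)
    (hPMu : PMu u) (hPMv : PMv u v) :
    IsSymmetry u v
      (fun t x y => 2 * x * Dx u t x y + y * Dy u t x y - 3 * u t x y)
      (fun t x y => 2 * x * Dx v t x y + y * Dy v t x y) := by
  have hA : (fun t x y => 2 * x * Dx u t x y + y * Dy u t x y - 3 * u t x y) =
      weightedEuler (-3) u := by
    funext t x y
    simp only [weightedEuler]
    ring
  have hB : (fun t x y => 2 * x * Dx v t x y + y * Dy v t x y) = weightedEuler 0 v := by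
    funext t x y
    simp only [weightedEuler]
    ring
  rw [hA, hB]
  constructor
  · intro t x y
    have h := congrFun (congrFun (congrFun (hPMu.weightedEuler_eq hu) t) x) y
    simp only [Pi.add_apply, Pi.sub_apply, Pi.mul_apply] at h
    rw [hu.Dy_weightedEuler, hu.Dx_weightedEuler, hu.Dy.Dy_weightedEuler,
      hu.Dx.Dt_weightedEuler, hu.Dx.Dx_weightedEuler, hu.Dx.Dy_weightedEuler]
    norm_num
    linear_combination h
  · intro t x y
    have h := congrFun (congrFun (congrFun (hPMv.weightedEuler_eq hu hv) t) x) y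
    simp only [Pi.add_apply, Pi.sub_apply, Pi.mul_apply] at h
    rw [hu.Dy_weightedEuler, hu.Dx_weightedEuler, hu.Dx.Dx_weightedEuler,
      hu.Dx.Dy_weightedEuler, hv.Dy_weightedEuler, hv.Dx_weightedEuler,
      hv.Dy.Dy_weightedEuler, hv.Dx.Dt_weightedEuler, hv.Dx.Dx_weightedEuler,
      hv.Dx.Dy_weightedEuler]
    norm_num
    linear_combination h
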